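/- Let L be a subfield of ℝ and let g(y) = b_k·y^k + b_{k−1}·y^{k−1} + ⋯ + b₀ ∈ L[y] be an irreducible polynomial of degree k ≥ 1. Then: (A) there exist polynomials g₀ ∈ L[y₁,…,y_k], g₁, …, g_k ∈ L[y], h₁ ∈ L[y,x], h₂ ∈ L[y], and an irreducible polynomial h ∈ L[y] such that g(x) − b_k·(x − g₁(y))⋯(x − g_k(y)) = h(y)·h₁(y,x) holds in L[y,x] and g₀(g₁(y), …, g_k(y)) − y = h(y)·h₂(y) holds in L[y]. (B) No matter how h, h₁, h₂, g₀, g₁, …, g_k are chosen so that these two identities hold with h irreducible, the following are equivalent: some complex root of g is constructible over L; every complex root of g is constructible over L; the degree of h is a power of 2. -/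

import Mathlib

open Polynomial

/-- The real quadratic closure of a subfield `K` of `ℝ`: the smallest subfield of `ℝ`
containing `K` that is closed under real square roots. -/
noncomputable def Qclo (K : Subfield ℝ) : Subfield ℝ :=
  sInf {M : Subfield ℝ | K ≤ M ∧ ∀ c : ℝ, c ∈ M → 0 ≤ c → Real.sqrt c ∈ M}

/-- A complex number is constructible over the subfield `L` of `ℝ` if its real and
imaginary parts both belong to the real quadratic closure of `L`. -/
def ConstructibleC (L : Subfield ℝ) (z : ℂ) : Prop :=
  z.re ∈ Qclo L ∧ z.im ∈ Qclo L

section Qclo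

theorem le_Qclo (L : Subfield ℝ) : L ≤ Qclo L :=
  le_sInf fun _ hM => hM.1

theorem sqrt_mem_Qclo {L : Subfield ℝ} {c : ℝ} (hc : c ∈ Qclo L) (h0 : 0 ≤ c) :
    Real.sqrt c ∈ Qclo L :=
  Subfield.mem_sInf.2 fun M hM => hM.2 c (Subfield.mem_sInf.1 hc M hM) h0

theorem Qclo_le {L M : Subfield ℝ} (hL : L ≤ M)
    (hM : ∀ c : ℝ, c ∈ M → 0 ≤ c → Real.sqrt c ∈ M) : Qclo L ≤ M :=
  sInf_le ⟨hL, hM⟩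

theorem mem_Qclo_of_sq_mem {L : Subfield ℝ} {x : ℝ} (hx : x ^ 2 ∈ Qclo L) : x ∈ Qclo L := by
  have h := sqrt_mem_Qclo hx (sq_nonneg x)
  rw [Real.sqrt_sq_eq_abs] at h
  rcases abs_choice x with h' | h' <;> rw [h'] at h
  · exact h
  · exact neg_mem_iff.1 h

/-- The complex numbers constructible over `L`, as a subfield of `ℂ`. -/
def constructibleSubfield (L : Subfield ℝ) : Subfield ℂ where
  carrier := {z | ConstructibleC L z}
  zero_mem' := ⟨by simp, by simp⟩
  one_mem' := ⟨by simp, by simp⟩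
  add_mem' := fun ha hb => ⟨add_mem ha.1 hb.1, add_mem ha.2 hb.2⟩
  neg_mem' := fun ha => ⟨neg_mem ha.1, neg_mem ha.2⟩
  mul_mem' := fun ha hb =>
    ⟨by rw [Complex.mul_re]; exact sub_mem (mul_mem ha.1 hb.1) (mul_mem ha.2 hb.2),
     by rw [Complex.mul_im]; exact add_mem (mul_mem ha.1 hb.2) (mul_mem ha.2 hb.1)⟩
  inv_mem' := fun a ha => by
    have hn : Complex.normSq a ∈ Qclo L := by
      rw [Complex.normSq_apply]
      exact add_mem (mul_mem ha.1 ha.1) (mul_mem ha.2 ha.2)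
    exact ⟨by rw [Complex.inv_re]; exact div_mem ha.1 hn,
      by rw [Complex.inv_im]; exact div_mem (neg_mem ha.2) hn⟩

theorem mem_constructibleSubfield_of_sq_mem {L : Subfield ℝ} {z : ℂ}
    (hz : z ^ 2 ∈ constructibleSubfield L) : z ∈ constructibleSubfield L := by
  obtain ⟨h1, h2⟩ := hz
  have e1 : (z ^ 2).re = z.re ^ 2 - z.im ^ 2 := by simp [pow_two]
  have e2 : (z ^ 2).im = 2 * z.re * z.im := by simp [pow_two]; ring
  rw [e1] at h1
  rw [e2] at h2
  have h3 : z.re ^ 2 + z.im ^ 2 ∈ Qclo L := by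
    refine mem_Qclo_of_sq_mem ?_
    convert add_mem (pow_mem h1 2) (pow_mem h2 2) using 1
    ring
  have two : (2 : ℝ) ∈ Qclo L := ofNat_mem _ 2
  constructor <;> refine mem_Qclo_of_sq_mem ?_
  · convert div_mem (add_mem h3 h1) two using 1
    ring
  · convert div_mem (sub_mem h3 h1) two using 1
    ring

theorem algebraMap_mem_constructibleSubfield (L : Subfield ℝ) (x : L) :
    algebraMap L ℂ x ∈ constructibleSubfield L := by
  change ((x : ℝ) : ℂ) ∈ constructibleSubfield L
  exact ⟨by simpa using le_Qclo L x.2, by simp⟩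

end Qclo

section TwoPower

variable {C : Type*} [Field C] [CharZero C] {Q : Subfield C}

theorem map_mem_of_finrank_eq_two (hQ : ∀ z : C, z ^ 2 ∈ Q → z ∈ Q)
    {F E : Type*} [Field F] [Field E] [Algebra F E] (hd : Module.finrank F E = 2)
    (φ : E →+* C) (hφ : ∀ x : F, φ (algebraMap F E x) ∈ Q) (x : E) : φ x ∈ Q := by
  have : FiniteDimensional F E := Module.finite_of_finrank_pos (by omega)
  have hx : IsIntegral F x := Algebra.IsIntegral.isIntegral x
  have hle : (minpoly F x).natDegree ≤ 2 := hd ▸ minpoly.natDegree_le x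
  have hdvd : (minpoly F x).natDegree ∣ 2 := hd ▸ minpoly.degree_dvd hx
  have hroot := minpoly.aeval F x
  have hm := minpoly.monic hx
  rcases (Nat.dvd_prime Nat.prime_two).1 hdvd with h1 | h2
  · obtain ⟨a, rfl⟩ := minpoly.natDegree_eq_one_iff.1 h1
    exact hφ a
  · set p := minpoly F x
    have hp2 : p.coeff 2 = 1 := by rw [← h2]; exact hm
    rw [aeval_eq_sum_range, h2] at hroot
    simp only [Finset.sum_range_succ, Finset.sum_range_zero, hp2, Algebra.smul_def] at hroot
    have hr := congrArg φ hroot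
    simp only [map_add, map_mul, map_pow, map_zero, map_one, pow_zero, pow_one] at hr
    set b := φ (algebraMap F E (p.coeff 1)) with hb
    set c := φ (algebraMap F E (p.coeff 0)) with hc
    have hbQ : b ∈ Q := hφ _
    have hcQ : c ∈ Q := hφ _
    have key : (2 * φ x + b) ^ 2 ∈ Q := by
      have : (2 * φ x + b) ^ 2 = b ^ 2 - 4 * c := by linear_combination 4 * hr
      rw [this]
      exact sub_mem (pow_mem hbQ 2) (mul_mem (ofNat_mem Q 4) hcQ)
    have h := hQ _ key
    have : φ x = ((2 * φ x + b) - b) / 2 := by ring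
    rw [this]
    exact div_mem (sub_mem h hbQ) (ofNat_mem Q 2)

theorem map_mem_of_finrank_eq_two_pow.{u} (hQ : ∀ z : C, z ^ 2 ∈ Q → z ∈ Q) (n : ℕ)
    {F E : Type u} [Field F] [Field E] [Algebra F E] [IsGalois F E]
    (hd : Module.finrank F E = 2 ^ n)
    (φ : E →+* C) (hφ : ∀ x : F, φ (algebraMap F E x) ∈ Q) (x : E) : φ x ∈ Q := by
  induction n generalizing F with
  | zero =>
    obtain ⟨y, rfl⟩ := (finrank_eq_one_iff_of_nonzero' (1 : E) one_ne_zero).1 hd x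
    rw [Algebra.smul_def, mul_one]
    exact hφ y
  | succ n ih =>
    have : FiniteDimensional F E := Module.finite_of_finrank_pos (by rw [hd]; positivity)
    have : Fact (Nat.Prime 2) := ⟨Nat.prime_two⟩
    obtain ⟨H, hH⟩ := Sylow.exists_subgroup_card_pow_prime (G := Gal(E/F)) 2 (n := n)
      (by rw [IsGalois.card_aut_eq_finrank, hd]; exact pow_dvd_pow 2 n.le_succ)
    have hE : Module.finrank (IntermediateField.fixedField H) E = 2 ^ n := by
      rw [IntermediateField.finrank_fixedField_eq_card, hH]
    refine ih hE fun y => ?_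
    have hF : Module.finrank F (IntermediateField.fixedField H) = 2 := by
      have := Module.finrank_mul_finrank F (IntermediateField.fixedField H) E
      rw [hE, hd, pow_succ'] at this
      exact Nat.eq_of_mul_eq_mul_right (by positivity) this
    exact map_mem_of_finrank_eq_two hQ hF
      (φ.comp (algebraMap (IntermediateField.fixedField H) E)) (fun x => hφ x) y

end TwoPower

section ProTwo

variable (F Ω : Type*) [Field F] [Field Ω] [Algebra F Ω]

/-- The elements of `Ω` fixed by `σ ^ 2 ^ n` for some `n` and all `F`-automorphisms `σ`. -/
def proTwoSubfield : Subfield Ω where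
  carrier := {x | ∃ n : ℕ, ∀ σ : Gal(Ω/F), (σ ^ 2 ^ n) x = x}
  zero_mem' := ⟨0, fun σ => map_zero _⟩
  one_mem' := ⟨0, fun σ => map_one _⟩
  add_mem' := by
    rintro a b ⟨m, hm⟩ ⟨n, hn⟩
    refine ⟨m + n, fun σ => ?_⟩
    have h1 := hm (σ ^ 2 ^ n)
    have h2 := hn (σ ^ 2 ^ m)
    rw [← pow_mul, ← pow_add] at h1 h2
    rw [add_comm n m] at h1
    rw [map_add, h1, h2]
  mul_mem' := by
    rintro a b ⟨m, hm⟩ ⟨n, hn⟩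
    refine ⟨m + n, fun σ => ?_⟩
    have h1 := hm (σ ^ 2 ^ n)
    have h2 := hn (σ ^ 2 ^ m)
    rw [← pow_mul, ← pow_add] at h1 h2
    rw [add_comm n m] at h1
    rw [map_mul, h1, h2]
  neg_mem' := by
    rintro a ⟨m, hm⟩
    exact ⟨m, fun σ => by rw [map_neg, hm]⟩
  inv_mem' := by
    rintro a ⟨m, hm⟩
    exact ⟨m, fun σ => by rw [map_inv₀, hm]⟩

variable {F Ω}

theorem algebraMap_mem_proTwoSubfield (x : F) : algebraMap F Ω x ∈ proTwoSubfield F Ω :=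
  ⟨0, fun _ => AlgEquiv.commutes _ _⟩

theorem mem_proTwoSubfield_of_sq_mem {w : Ω} (hw : w ^ 2 ∈ proTwoSubfield F Ω) :
    w ∈ proTwoSubfield F Ω := by
  obtain ⟨n, hn⟩ := hw
  refine ⟨n + 1, fun σ => ?_⟩
  have h := hn σ
  rw [map_pow] at h
  rw [pow_succ, pow_mul, pow_two, AlgEquiv.mul_apply]
  rcases sq_eq_sq_iff_eq_or_eq_neg.1 h with h' | h'
  · rw [h', h']
  · rw [h', map_neg, h', neg_neg]

theorem finrank_eq_two_pow_of_root_mem [Normal F Ω] {K : Type*} [Field K] [Algebra F K]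
    [FiniteDimensional F K] [IsGalois F K] (ψ : K →ₐ[F] Ω) {g : F[X]} (hg : Irreducible g)
    [g.IsSplittingField F K] {w : Ω} (hw : aeval w g = 0) (hw' : w ∈ proTwoSubfield F Ω) :
    ∃ s : ℕ, Module.finrank F K = 2 ^ s := by
  obtain ⟨n, hn⟩ := hw'
  let : Algebra K Ω := ψ.toRingHom.toAlgebra
  have : IsScalarTower F K Ω := IsScalarTower.of_algebraMap_eq fun x => (ψ.commutes x).symm
  have : Fact (Nat.Prime 2) := ⟨Nat.prime_two⟩
  rw [← IsGalois.card_aut_eq_finrank F K]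
  refine IsPGroup.iff_card.1 fun σ => ⟨n, ?_⟩
  have hfix : ∀ r : Ω, aeval r g = 0 → ∀ τ : Gal(Ω/F), (τ ^ 2 ^ n) r = r := by
    intro r hr τ
    have hmin : minpoly F r = minpoly F w := by
      rw [← minpoly.eq_of_irreducible hg hr, ← minpoly.eq_of_irreducible hg hw]
    obtain ⟨ρ, hρ⟩ := (Normal.minpoly_eq_iff_mem_orbit Ω).1 hmin
    change ρ w = r at hρ
    have h := congrArg ρ (hn (ρ⁻¹ * τ * ρ))
    have hconj : (ρ⁻¹ * τ * ρ) ^ 2 ^ n = ρ⁻¹ * τ ^ 2 ^ n * ρ := by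
      simpa using conj_pow (a := ρ⁻¹) (b := τ) (i := 2 ^ n)
    rw [hconj, ← AlgEquiv.mul_apply, ← mul_assoc, mul_inv_cancel_left, AlgEquiv.mul_apply,
      hρ] at h
    exact h
  have hlift : ∀ (m : ℕ) (x : K),
      ((σ.liftNormal Ω) ^ m) (algebraMap K Ω x) = algebraMap K Ω ((σ ^ m) x) := by
    intro m
    induction m with
    | zero => intro x; rfl
    | succ m ih =>
      intro x
      rw [pow_succ, pow_succ, AlgEquiv.mul_apply, AlgEquiv.mul_apply,
        AlgEquiv.liftNormal_commutes, ih]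
  have hhom : ((σ ^ 2 ^ n : Gal(K/F)) : K →ₐ[F] K) = AlgHom.id F K := by
    refine AlgHom.ext_of_adjoin_eq_top (IsSplittingField.adjoin_rootSet K g) fun x hx => ?_
    apply (algebraMap K Ω).injective
    change algebraMap K Ω ((σ ^ 2 ^ n) x) = algebraMap K Ω x
    rw [← hlift]
    refine hfix _ ?_ _
    rw [aeval_algebraMap_apply, (mem_rootSet.1 hx).2, map_zero]
  exact AlgEquiv.ext fun x => DFunLike.congr_fun hhom x

end ProTwo

theorem exists_map_eq_of_constructibleC {L : Subfield ℝ} {Ω : Type*} [Field Ω] [Algebra L Ω]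
    [IsAlgClosed Ω] (φ : Ω →ₐ[L] ℂ) {z : ℂ} (hz : ConstructibleC L z) :
    ∃ w ∈ proTwoSubfield L Ω, φ w = z := by
  set T : Subfield ℂ := (proTwoSubfield L Ω).map φ.toRingHom
  have hT : ∀ z : ℂ, z ^ 2 ∈ T → z ∈ T := by
    rintro z ⟨y, hy, hyz⟩
    change φ y = z ^ 2 at hyz
    obtain ⟨w, rfl⟩ := IsAlgClosed.exists_pow_nat_eq y (n := 2) (by norm_num)
    have hw := mem_proTwoSubfield_of_sq_mem hy
    rw [map_pow] at hyz
    rcases sq_eq_sq_iff_eq_or_eq_neg.1 hyz with h | h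
    · exact ⟨w, hw, h⟩
    · exact ⟨-w, neg_mem hw, by change φ (-w) = z; rw [map_neg, h, neg_neg]⟩
  have hle : Qclo L ≤ T.comap Complex.ofRealHom := by
    refine Qclo_le (fun x hx => ?_) fun c hc h0 => ?_
    · exact ⟨algebraMap L Ω ⟨x, hx⟩, algebraMap_mem_proTwoSubfield _, φ.commutes _⟩
    · refine hT _ ?_
      rw [← map_pow, Real.sq_sqrt h0]
      exact hc
  have hI : Complex.I ∈ T := hT _ (by rw [Complex.I_sq]; exact neg_mem (one_mem T))
  have : z ∈ T := by
    rw [← Complex.re_add_im z]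
    exact add_mem (hle hz.1) (mul_mem (hle hz.2) hI)
  exact this

section Resolvent

variable {F : Type*} [Field F] {k : ℕ}

theorem isSplittingField_adjoinRoot {g h h₂ : F[X]} [Fact (Irreducible h)] {h₁ : F[X][X]}
    {g₀ : MvPolynomial (Fin k) F} {gs : Fin k → F[X]} (hg : g ≠ 0)
    (e₁ : g.map C - C (C g.leadingCoeff) * ∏ i, (X - C (gs i)) = C h * h₁)
    (e₂ : MvPolynomial.aeval gs g₀ - X = h * h₂) :
    g.IsSplittingField F (AdjoinRoot h) := by
  have hprod : g.map (algebraMap F (AdjoinRoot h)) =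
      C (algebraMap F (AdjoinRoot h) g.leadingCoeff) * ∏ i, (X - C (AdjoinRoot.mk h (gs i))) := by
    have := congrArg (Polynomial.map (AdjoinRoot.mk h)) e₁
    simp only [Polynomial.map_sub, Polynomial.map_mul, Polynomial.map_map, map_C,
      Polynomial.map_prod, map_X, AdjoinRoot.mk_self, map_zero, zero_mul] at this
    exact sub_eq_zero.1 this
  have hroot : MvPolynomial.aeval (fun i => AdjoinRoot.mk h (gs i)) g₀ = AdjoinRoot.root h := by
    have := congrArg (AdjoinRoot.mkₐ h) e₂
    rw [map_sub, MvPolynomial.comp_aeval_apply] at this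
    refine sub_eq_zero.1 (this.trans ?_)
    rw [map_mul]
    exact mul_eq_zero_of_left AdjoinRoot.mk_self _
  refine ⟨?_, ?_⟩
  · rw [hprod]
    exact (Splits.C _).mul (Splits.prod fun i _ => Splits.X_sub_C _)
  · rw [eq_top_iff, ← AdjoinRoot.adjoinRoot_eq_top, Algebra.adjoin_le_iff, Set.singleton_subset_iff,
      SetLike.mem_coe, ← hroot]
    have hsub : Set.range (fun i => AdjoinRoot.mk h (gs i)) ⊆ g.rootSet (AdjoinRoot h) := by
      rintro _ ⟨i, rfl⟩
      rw [mem_rootSet]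
      refine ⟨hg, ?_⟩
      rw [aeval_def, ← eval_map, hprod, eval_mul, eval_prod,
        Finset.prod_eq_zero (Finset.mem_univ i) (by simp), mul_zero]
    refine Algebra.adjoin_mono hsub ?_
    rw [Algebra.adjoin_range_eq_range_aeval]
    exact ⟨g₀, rfl⟩

theorem exists_irreducible_resolvent (K : Type*) [Field K] [Algebra F K] {g : F[X]} [g.IsSplittingField F K]
    (hgs : g.Separable) (hgd : g.natDegree = k) :
    ∃ (g₀ : MvPolynomial (Fin k) F) (gs : Fin k → F[X]) (h h₂ : F[X]) (h₁ : F[X][X]),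
      Irreducible h ∧
      g.map C - C (C g.leadingCoeff) * ∏ i, (X - C (gs i)) = C h * h₁ ∧
      MvPolynomial.aeval gs g₀ - X = h * h₂ := by
  have : FiniteDimensional F K := IsSplittingField.finiteDimensional K g
  have : IsGalois F K := IsGalois.of_separable_splitting_field hgs
  obtain ⟨α, hα⟩ := Field.exists_primitive_element F K
  have hint : IsIntegral F α := Algebra.IsIntegral.isIntegral α
  have hadj : Algebra.adjoin F {α} = ⊤ := by
    rw [← IntermediateField.adjoin_simple_toSubalgebra_of_isAlgebraic hint.isAlgebraic, hα]
    rfl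
  have hpoly : ∀ x : K, ∃ p : F[X], aeval α p = x := by
    intro x
    have hx : x ∈ Algebra.adjoin F {α} := hadj ▸ Algebra.mem_top
    rwa [Algebra.adjoin_singleton_eq_range_aeval] at hx
  have hsplit : (g.map (algebraMap F K)).Splits := IsSplittingField.splits K g
  obtain ⟨l, hl⟩ : ∃ l : List K, (l : Multiset K) = (g.map (algebraMap F K)).roots :=
    Quot.exists_rep _
  have hlen : l.length = k := by
    rw [← hgd, ← natDegree_map (algebraMap F K), hsplit.natDegree_eq_card_roots, ← hl,
      Multiset.coe_card]
  subst hlen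
  have hprod : g.map (algebraMap F K) =
      C (algebraMap F K g.leadingCoeff) * ∏ i, (X - C (l.get i)) := by
    conv_lhs => rw [hsplit.eq_prod_roots, ← hl, leadingCoeff_map]
    rw [Multiset.map_coe, Multiset.prod_coe, ← Fin.prod_univ_fun_getElem]
    rfl
  choose gs hgs' using fun i : Fin l.length => hpoly (l.get i)
  obtain ⟨g₀, hg₀⟩ : ∃ g₀ : MvPolynomial (Fin l.length) F, MvPolynomial.aeval l.get g₀ = α := by
    have hα' : α ∈ Algebra.adjoin F (g.rootSet K) :=
      (IsSplittingField.adjoin_rootSet K g).symm ▸ Algebra.mem_top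
    have hsub : g.rootSet K ⊆ Set.range l.get := by
      intro x hx
      have : x ∈ (g.map (algebraMap F K)).roots := by
        simpa [rootSet, aroots] using hx
      rw [← hl, Multiset.mem_coe] at this
      exact List.mem_iff_get.1 this
    have := Algebra.adjoin_mono hsub hα'
    rwa [Algebra.adjoin_range_eq_range_aeval] at this
  have h1 : C (minpoly F α) ∣ g.map C - C (C g.leadingCoeff) * ∏ i, (X - C (gs i)) := by
    rw [C_dvd_iff_dvd_coeff]
    intro i
    apply minpoly.dvd
    let θ : F[X] →+* K := (aeval α : F[X] →ₐ[F] K)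
    have hθ : θ.comp C = algebraMap F K := RingHom.ext fun x => aeval_C α x
    have hθgs : ∀ i, θ (gs i) = l.get i := hgs'
    change θ _ = 0
    rw [← coeff_map]
    have : Polynomial.map θ (g.map C - C (C g.leadingCoeff) * ∏ i, (X - C (gs i))) = 0 := by
      simp only [Polynomial.map_sub, Polynomial.map_mul, Polynomial.map_map, map_C,
        Polynomial.map_prod, map_X, hθgs, hθ]
      rw [hprod, ← hθ, RingHom.comp_apply, sub_self]
    rw [this, coeff_zero]
  have h2 : minpoly F α ∣ MvPolynomial.aeval gs g₀ - X := by
    apply minpoly.dvd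
    rw [map_sub, aeval_X, MvPolynomial.comp_aeval_apply]
    simp only [hgs']
    exact sub_eq_zero.2 hg₀
  obtain ⟨p, hp⟩ := h1
  obtain ⟨q, hq⟩ := h2
  exact ⟨g₀, gs, minpoly F α, q, p, minpoly.irreducible hint, hp, hq⟩

end Resolvent

/-- Let `L ⊆ ℝ` be a subfield and `g ∈ L[y]` irreducible of degree `k ≥ 1`.
(A) There exist `g₀ ∈ L[y₁,…,y_k]`, `g₁,…,g_k, h₂ ∈ L[y]`, `h₁ ∈ L[y,x]` and an
irreducible `h ∈ L[y]` with `g(x) − b_k·(x−g₁(y))⋯(x−g_k(y)) = h(y)·h₁(y,x)` in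
`L[y,x]` and `g₀(g₁(y),…,g_k(y)) − y = h(y)·h₂(y)` in `L[y]` (here `L[y,x]` is
realized as `Polynomial (Polynomial L)`, `y` inner and `x` outer).
(B) For any such choice: some complex root of `g` is constructible over `L` iff every
complex root of `g` is constructible over `L` iff `deg h` is a power of `2`. -/
theorem statement17 (L : Subfield ℝ) (k : ℕ) (hk : 1 ≤ k)
    (g : Polynomial L) (hgi : Irreducible g) (hgd : g.natDegree = k) :
    (∃ (g₀ : MvPolynomial (Fin k) L) (gs : Fin k → Polynomial L)
       (h h₂ : Polynomial L) (h₁ : Polynomial (Polynomial L)),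
       Irreducible h ∧
       Polynomial.map (Polynomial.C) g -
           Polynomial.C (Polynomial.C g.leadingCoeff) *
             ∏ i : Fin k, (Polynomial.X - Polynomial.C (gs i)) =
         Polynomial.C h * h₁ ∧
       MvPolynomial.aeval gs g₀ - Polynomial.X = h * h₂) ∧
    (∀ (g₀ : MvPolynomial (Fin k) L) (gs : Fin k → Polynomial L)
       (h h₂ : Polynomial L) (h₁ : Polynomial (Polynomial L)),
       Irreducible h →
       Polynomial.map (Polynomial.C) g -
           Polynomial.C (Polynomial.C g.leadingCoeff) *
             ∏ i : Fin k, (Polynomial.X - Polynomial.C (gs i)) =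
         Polynomial.C h * h₁ →
       MvPolynomial.aeval gs g₀ - Polynomial.X = h * h₂ →
       (((∃ z : ℂ, Polynomial.eval₂ ((algebraMap ℝ ℂ).comp L.subtype) z g = 0 ∧
             ConstructibleC L z) ↔
           (∀ z : ℂ, Polynomial.eval₂ ((algebraMap ℝ ℂ).comp L.subtype) z g = 0 →
             ConstructibleC L z)) ∧
        ((∃ z : ℂ, Polynomial.eval₂ ((algebraMap ℝ ℂ).comp L.subtype) z g = 0 ∧
             ConstructibleC L z) ↔ ∃ s : ℕ, h.natDegree = 2 ^ s))) := by
  refine ⟨exists_irreducible_resolvent g.SplittingField hgi.separable hgd,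
    fun g₀ gs h h₂ h₁ hh e₁ e₂ => ?_⟩
  have : Fact (Irreducible h) := ⟨hh⟩
  have := isSplittingField_adjoinRoot hgi.ne_zero e₁ e₂
  let K := AdjoinRoot h
  have : FiniteDimensional L K := IsSplittingField.finiteDimensional K g
  have : IsGalois L K := IsGalois.of_separable_splitting_field hgi.separable
  have hdeg : Module.finrank L K = h.natDegree := by
    rw [(AdjoinRoot.powerBasis hh.ne_zero).finrank, AdjoinRoot.powerBasis_dim]
  have hpow_of_some : (∃ z : ℂ, eval₂ ((algebraMap ℝ ℂ).comp L.subtype) z g = 0 ∧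
      ConstructibleC L z) → ∃ s : ℕ, h.natDegree = 2 ^ s := by
    rintro ⟨z, hz, hzc⟩
    let φ : AlgebraicClosure L →ₐ[L] ℂ := IsAlgClosed.lift
    obtain ⟨w, hw, rfl⟩ := exists_map_eq_of_constructibleC φ hzc
    have hw0 : aeval w g = 0 :=
      (map_eq_zero φ).1 ((aeval_algHom_apply φ w g).symm.trans hz)
    rw [← hdeg]
    exact finrank_eq_two_pow_of_root_mem (IsAlgClosed.lift : K →ₐ[L] AlgebraicClosure L) hgi hw0 hw
  have hall_of_pow : (∃ s : ℕ, h.natDegree = 2 ^ s) →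
      ∀ z : ℂ, eval₂ ((algebraMap ℝ ℂ).comp L.subtype) z g = 0 → ConstructibleC L z := by
    rintro ⟨s, hs⟩ z hz
    let φ : K →ₐ[L] ℂ := IsAlgClosed.lift
    have hz' : z ∈ g.rootSet ℂ := mem_rootSet.2 ⟨hgi.ne_zero, hz⟩
    rw [← (IsSplittingField.splits K g).image_rootSet φ] at hz'
    obtain ⟨x, -, rfl⟩ := hz'
    refine map_mem_of_finrank_eq_two_pow (Q := constructibleSubfield L)
      (fun _ => mem_constructibleSubfield_of_sq_mem) s (hdeg.trans hs) (φ : K →+* ℂ)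
      (fun y => ?_) x
    rw [RingHom.coe_coe, φ.commutes]
    exact algebraMap_mem_constructibleSubfield L y
  have hsome_of_all : (∀ z : ℂ, eval₂ ((algebraMap ℝ ℂ).comp L.subtype) z g = 0 →
      ConstructibleC L z) → ∃ z : ℂ, eval₂ ((algebraMap ℝ ℂ).comp L.subtype) z g = 0 ∧
      ConstructibleC L z := by
    intro H
    obtain ⟨z, hz⟩ := IsAlgClosed.exists_aeval_eq_zero ℂ g hgi.degree_pos.ne'
    exact ⟨z, hz, H z hz⟩
  exact ⟨⟨fun H => hall_of_pow (hpow_of_some H), hsome_of_all⟩,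
    ⟨hpow_of_some, fun H => hsome_of_all (hall_of_pow H)⟩⟩
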